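/- arXiv:2301.12563 — 6 statements merged into one kernel-verified Lean document; each statement's English description precedes it below -/
import Mathlib

section
/- Suppose k = 2^m for some natural number m and the family system F is monotone. For an integer r ≥ 1 let ρ₂(r) denote the least power of 2 that is ≥ r, and set ρ₂(0) = 0. If R is a feasible rate function, then R' := ρ₂ ∘ R is also a feasible rate function, all of whose values lie in {0} ∪ {2^0, 2^1, …, 2^m}, and weight(R') ≤ 2·weight(R). -/
/-- A rate function `R : E → {0,1,…,k}` is feasible for the family system `F` if
`R` takes values in `{0,…,k}` and, for every `i ∈ {1,…,k}`, the set of edges of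
rate at least `i` belongs to `F i`. -/
def FeasibleRate {E : Type*} (k : ℕ) (F : ℕ → Set (Set E)) (R : E → ℕ) : Prop :=
  (∀ e, R e ≤ k) ∧ ∀ i, 1 ≤ i → i ≤ k → {e | i ≤ R e} ∈ F i

/-- The weight of a rate function: `weight(R) = Σ_{e ∈ E} R(e)·w(e)`. -/
noncomputable def rateWeight {E : Type*} [Fintype E] (w : E → ℝ) (R : E → ℕ) : ℝ :=
  ∑ e, (R e : ℝ) * w e

/-- Rounding up to a power of two does not cross any power of two. -/
theorem roundUp_le_two_pow_iff {ρ : ℕ → ℕ} (hρ0 : ρ 0 = 0)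
    (hρ : ∀ r, 1 ≤ r → IsLeast {p : ℕ | r ≤ p ∧ ∃ t : ℕ, p = 2 ^ t} (ρ r)) (r s : ℕ) :
    ρ r ≤ 2 ^ s ↔ r ≤ 2 ^ s := by
  rcases Nat.eq_zero_or_pos r with rfl | hr
  · simp [hρ0]
  · exact ⟨(hρ r hr).1.1.trans, fun h => (hρ r hr).2 ⟨h, s, rfl⟩⟩

/-- Every superlevel set of the rounded values is a superlevel set, at a level that is no
higher, of the original values. -/
theorem exists_le_roundUp_iff {ρ : ℕ → ℕ} (hρ0 : ρ 0 = 0)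
    (hρ : ∀ r, 1 ≤ r → IsLeast {p : ℕ | r ≤ p ∧ ∃ t : ℕ, p = 2 ^ t} (ρ r))
    {i : ℕ} (hi : 1 ≤ i) : ∃ j, 1 ≤ j ∧ j ≤ i ∧ ∀ r, i ≤ ρ r ↔ j ≤ r := by
  rcases hi.eq_or_lt with rfl | hi
  · refine ⟨1, le_rfl, le_rfl, fun r => ?_⟩
    rcases Nat.eq_zero_or_pos r with rfl | hr
    · simp [hρ0]
    · exact ⟨fun _ => hr, fun h => h.trans (hρ r hr).1.1⟩
  · obtain ⟨s, hs⟩ := Nat.exists_eq_add_one.mpr (Nat.clog_pos one_lt_two hi)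
    have hlt : 2 ^ s < i := Nat.pow_lt_of_lt_clog (by omega)
    have hle : i ≤ 2 ^ (s + 1) := hs ▸ Nat.le_pow_clog one_lt_two i
    refine ⟨2 ^ s + 1, by omega, hlt, fun r => ?_⟩
    rw [Nat.succ_le_iff, ← not_le, ← roundUp_le_two_pow_iff hρ0 hρ r s, not_le]
    refine ⟨hlt.trans_le, fun h => ?_⟩
    rcases Nat.eq_zero_or_pos r with rfl | hr
    · simp [hρ0] at h
    · obtain ⟨t, ht⟩ := (hρ r hr).1.2
      rw [ht] at h ⊢
      exact hle.trans (Nat.pow_le_pow_right two_pos ((Nat.pow_lt_pow_iff_right one_lt_two).mp h))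

/-- Rounding up to a power of two at most doubles. -/
theorem roundUp_le_two_mul {ρ : ℕ → ℕ} (hρ0 : ρ 0 = 0)
    (hρ : ∀ r, 1 ≤ r → IsLeast {p : ℕ | r ≤ p ∧ ∃ t : ℕ, p = 2 ^ t} (ρ r)) (r : ℕ) :
    ρ r ≤ 2 * r := by
  rcases Nat.eq_zero_or_pos r with rfl | hr
  · simp [hρ0]
  · obtain ⟨t, ht⟩ := (hρ r hr).1.2
    cases t with
    | zero => rw [ht]; omega
    | succ u =>
      have h := roundUp_le_two_pow_iff hρ0 hρ r u
      rw [pow_succ] at ht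
      have : 0 < 2 ^ u := by positivity
      omega

theorem stmt2 {E : Type*} [Fintype E]
    (w : E → ℝ) (hw : ∀ e, 0 ≤ w e)
    (k m : ℕ) (hk : k = 2 ^ m)
    (F : ℕ → Set (Set E))
    (hmono : ∀ i j, 1 ≤ i → i ≤ j → j ≤ k → F i ⊆ F j)
    -- `ρ` rounds up to the nearest power of two: `ρ 0 = 0`, and for `r ≥ 1`,
    -- `ρ r` is the least power of 2 that is `≥ r`.
    (ρ : ℕ → ℕ) (hρ0 : ρ 0 = 0)
    (hρ : ∀ r, 1 ≤ r → IsLeast {p : ℕ | r ≤ p ∧ ∃ t : ℕ, p = 2 ^ t} (ρ r))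
    (R : E → ℕ) (hR : FeasibleRate k F R) :
    FeasibleRate k F (fun e => ρ (R e)) ∧
    (∀ e, ρ (R e) = 0 ∨ ∃ t ≤ m, ρ (R e) = 2 ^ t) ∧
    rateWeight w (fun e => ρ (R e)) ≤ 2 * rateWeight w R := by
  obtain ⟨hRk, hRF⟩ := hR
  have hle : ∀ e, ρ (R e) ≤ 2 ^ m := fun e =>
    (roundUp_le_two_pow_iff hρ0 hρ _ m).mpr (hk ▸ hRk e)
  refine ⟨⟨fun e => hk ▸ hle e, fun i hi hik => ?_⟩, fun e => ?_, ?_⟩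
  · obtain ⟨j, hj, hji, hiff⟩ := exists_le_roundUp_iff hρ0 hρ hi
    simp only [hiff]
    exact hmono j i hj hji hik (hRF j hj (hji.trans hik))
  · rcases Nat.eq_zero_or_pos (R e) with h | h
    · exact Or.inl (h ▸ hρ0)
    · obtain ⟨t, ht⟩ := (hρ _ h).1.2
      exact Or.inr ⟨t, (Nat.pow_le_pow_iff_right one_lt_two).mp (ht ▸ hle e), ht⟩
  · unfold rateWeight
    rw [Finset.mul_sum]
    refine Finset.sum_le_sum fun e _ => ?_
    rw [← mul_assoc]
    exact mul_le_mul_of_nonneg_right (mod_cast roundUp_le_two_mul hρ0 hρ (R e)) (hw e)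
end

section
/- Suppose k = 2^m for some natural number m and let R' be a feasible rate function all of whose nonzero values are powers of 2. Set m_0 = 1 and m_j = 2^{j-1}+1 for 1 ≤ j ≤ m. Then {e ∈ E : R'(e) ≥ m_j} ∈ F(m_j) for each j (so F(m_j) is nonempty), and if c_j denotes the minimum of w(A) over A ∈ F(m_j) (this minimum exists since the members of F(m_j) are subsets of the finite set E), then Σ_{j=0}^{m} 2^j·c_j ≤ 2·weight(R'). -/
/-- The weight of a subset of edges: `w(S) = Σ_{e ∈ S} w(e)`. -/
noncomputable def setWeight {E : Type*} [Fintype E] (w : E → ℝ) (A : Set E) : ℝ :=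
  ∑ e ∈ A.toFinite.toFinset, w e

/-- `m_0 = 1` and `m_j = 2^{j-1} + 1` for `j ≥ 1`. -/
def mIdx (j : ℕ) : ℕ := if j = 0 then 1 else 2 ^ (j - 1) + 1

theorem mIdx_le_two_pow {j m : ℕ} (h : j ≤ m) : mIdx j ≤ 2 ^ m := by
  unfold mIdx
  split_ifs with hj
  · exact Nat.one_le_two_pow
  · exact Nat.pow_lt_pow_right one_lt_two (by omega)

theorem one_le_mIdx (j : ℕ) : 1 ≤ mIdx j := by
  unfold mIdx
  split_ifs <;> simp

theorem le_of_mIdx_le_two_pow {j t : ℕ} (h : mIdx j ≤ 2 ^ t) : j ≤ t := by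
  unfold mIdx at h
  split_ifs at h with hj
  · omega
  · have := (Nat.pow_lt_pow_iff_right (a := 2) one_lt_two).mp (Nat.lt_of_succ_le h)
    omega

theorem sum_two_pow_mIdx_le (n r : ℕ) (hr : r = 0 ∨ ∃ t : ℕ, r = 2 ^ t) :
    ∑ j ∈ Finset.range n, (if mIdx j ≤ r then 2 ^ j else 0) ≤ 2 * r := by
  rw [← Finset.sum_filter]
  obtain rfl | ⟨t, rfl⟩ := hr
  · refine (Finset.sum_eq_zero fun j hj => ?_).le
    have := (Finset.mem_filter.mp hj).2
    have := one_le_mIdx j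
    omega
  · calc ∑ j ∈ Finset.range n with mIdx j ≤ 2 ^ t, 2 ^ j
        ≤ ∑ j ∈ Finset.range (t + 1), 2 ^ j := by
          refine Finset.sum_le_sum_of_subset fun j hj => ?_
          have := le_of_mIdx_le_two_pow (Finset.mem_filter.mp hj).2
          exact Finset.mem_range.mpr (by omega)
      _ ≤ 2 * 2 ^ t := by
          rw [← pow_succ']
          exact (Nat.geomSum_lt le_rfl fun j hj => Finset.mem_range.mp hj).le

theorem setWeight_setOf {E : Type*} [Fintype E] (w : E → ℝ) (p : E → Prop) [DecidablePred p] :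
    setWeight w {e | p e} = ∑ e, if p e then w e else 0 := by
  rw [setWeight, ← Finset.sum_filter]
  congr 1
  ext e
  simp

theorem stmt3 {E : Type*} [Fintype E]
    (w : E → ℝ) (hw : ∀ e, 0 ≤ w e)
    (k m : ℕ) (hk : k = 2 ^ m)
    (F : ℕ → Set (Set E))
    (R' : E → ℕ) (hR' : FeasibleRate k F R')
    (hpow : ∀ e, R' e = 0 ∨ ∃ t : ℕ, R' e = 2 ^ t) :
    (∀ j ≤ m, {e | mIdx j ≤ R' e} ∈ F (mIdx j)) ∧
    ∀ c : ℕ → ℝ,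
      (∀ j ≤ m, IsLeast (setWeight w '' F (mIdx j)) (c j)) →
      ∑ j ∈ Finset.range (m + 1), (2 : ℝ) ^ j * c j ≤ 2 * rateWeight w R' := by
  have hmem : ∀ j ≤ m, {e | mIdx j ≤ R' e} ∈ F (mIdx j) := fun j hj =>
    hR'.2 _ (one_le_mIdx j) (hk ▸ mIdx_le_two_pow hj)
  refine ⟨hmem, fun c hc => ?_⟩
  calc ∑ j ∈ Finset.range (m + 1), (2 : ℝ) ^ j * c j
      ≤ ∑ j ∈ Finset.range (m + 1), (2 : ℝ) ^ j * setWeight w {e | mIdx j ≤ R' e} := by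
        refine Finset.sum_le_sum fun j hj => ?_
        have hjm : j ≤ m := Nat.lt_succ_iff.mp (Finset.mem_range.mp hj)
        exact mul_le_mul_of_nonneg_left ((hc j hjm).2 ⟨_, hmem j hjm, rfl⟩) (by positivity)
    _ = ∑ e, (∑ j ∈ Finset.range (m + 1), if mIdx j ≤ R' e then (2 : ℝ) ^ j else 0) * w e := by
        simp only [setWeight_setOf, Finset.mul_sum, Finset.sum_mul]
        rw [Finset.sum_comm]
        simp only [mul_ite, ite_mul, mul_zero, zero_mul]
    _ ≤ ∑ e, 2 * ((R' e : ℝ) * w e) := by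
        refine Finset.sum_le_sum fun e _ => ?_
        rw [← mul_assoc]
        refine mul_le_mul_of_nonneg_right ?_ (hw e)
        exact_mod_cast sum_two_pow_mIdx_le (m + 1) (R' e) (hpow e)
    _ = 2 * rateWeight w R' := by rw [rateWeight, Finset.mul_sum]
end

section
/- Let m be a natural number and let A_0,…,A_m and B_0,…,B_m be subsets of E such that B_m ⊆ A_m, B_{j+1} ⊆ B_j for every 0 ≤ j < m, and B_j ⊆ A_j ∪ B_{j+1} for every 0 ≤ j < m. Define R(e) = 2^{j(e)} where j(e) is the largest index j with e ∈ B_j, and R(e) = 0 if e lies in no B_j. Then Σ_{e ∈ E} R(e)·w(e) ≤ Σ_{j=0}^{m} 2^j·w(A_j). -/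
open Classical in
theorem setWeight_eq_sum_ite {E : Type*} [Fintype E] (w : E → ℝ) (A : Set E) :
    setWeight w A = ∑ e, if e ∈ A then w e else 0 := by
  rw [setWeight, ← Finset.sum_filter]
  congr 1
  ext e
  simp

theorem stmt4 {E : Type*} [Fintype E]
    (w : E → ℝ) (hw : ∀ e, 0 ≤ w e)
    (m : ℕ) (A B : ℕ → Set E)
    (hBA : B m ⊆ A m)
    (hBnest : ∀ j < m, B (j + 1) ⊆ B j)
    (hBAB : ∀ j < m, B j ⊆ A j ∪ B (j + 1))
    -- `R(e) = 2^{j(e)}` where `j(e)` is the largest `j ≤ m` with `e ∈ B j`,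
    -- and `R(e) = 0` if `e` lies in no `B j`:
    (R : E → ℕ)
    (hR0 : ∀ e, (∀ j ≤ m, e ∉ B j) → R e = 0)
    (hRpow : ∀ e j, j ≤ m → e ∈ B j → (∀ j', j < j' → j' ≤ m → e ∉ B j') →
      R e = 2 ^ j) :
    rateWeight w R ≤ ∑ j ∈ Finset.range (m + 1), (2 : ℝ) ^ j * setWeight w (A j) := by
  classical
  simp only [setWeight_eq_sum_ite, rateWeight, Finset.mul_sum]
  rw [Finset.sum_comm]
  refine Finset.sum_le_sum fun e _ => ?_
  have hnonneg : ∀ j ∈ Finset.range (m + 1), 0 ≤ (2 : ℝ) ^ j * (if e ∈ A j then w e else 0) := by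
    intro j _
    have := hw e
    split_ifs <;> positivity
  by_cases h : ∃ j ≤ m, e ∈ B j
  · obtain ⟨i, him, hi⟩ := h
    set k := Nat.findGreatest (fun j => e ∈ B j) m
    have hkm : k ≤ m := Nat.findGreatest_le m
    have hk : e ∈ B k := Nat.findGreatest_spec (P := fun j => e ∈ B j) him hi
    have hmax : ∀ j, k < j → j ≤ m → e ∉ B j := fun j h₁ h₂ => Nat.findGreatest_is_greatest h₁ h₂
    have hA : e ∈ A k := by
      rcases hkm.eq_or_lt with h | h
      · rw [h] at hk ⊢
        exact hBA hk
      · exact (hBAB k h hk).resolve_right (hmax (k + 1) k.lt_succ_self h)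
    have := Finset.single_le_sum hnonneg (Finset.mem_range.2 (Nat.lt_succ_of_le hkm))
    rw [hRpow e k hkm hk hmax]
    simpa [hA] using this
  · push Not at h
    rw [hR0 e h]
    simpa using Finset.sum_nonneg hnonneg
end

section
/- Let G be a finite simple graph and let T' ⊆ T be subsets of the vertex set of G with T' nonempty. Let Y be a connected acyclic subgraph of G with T ⊆ V(Y), and let Y' be a connected acyclic subgraph of G with T' ⊆ V(Y'). Then there exists a connected acyclic subgraph Z of G with T ⊆ V(Z) and E(Y') ⊆ E(Z) ⊆ E(Y) ∪ E(Y'); that is, a Steiner tree over a larger terminal set and a Steiner tree over a smaller terminal set can be merged, pruning only edges of the lower-priority tree. -/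
namespace SimpleGraph.Subgraph

/-- Adding isolated vertices to an acyclic subgraph keeps it acyclic. -/
theorem isAcyclic_spanningCoe {V : Type*} {G : SimpleGraph V} {H : G.Subgraph}
    (h : H.coe.IsAcyclic) : H.spanningCoe.IsAcyclic := by
  intro u p hp
  have hs : ∀ x ∈ p.support, x ∈ H.verts := by
    intro x hx
    obtain ⟨e, he, hxe⟩ := (Walk.mem_support_iff_exists_mem_edges_of_not_nil hp.not_nil).mp hx
    obtain ⟨y, rfl⟩ := hxe
    exact H.edge_vert (p.adj_of_mem_edges he)
  have hq : (p.induce H.verts hs).IsCycle := by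
    apply Walk.IsCycle.of_map (f := (Embedding.induce H.verts).toHom)
    rwa [Walk.map_induce]
  exact (h.comap (G := H.spanningCoe.induce H.verts) ⟨id, fun h => h⟩ Function.injective_id) _ hq

/-- An acyclic subgraph of a connected subgraph extends to a spanning tree of the latter. -/
theorem Connected.exists_isAcyclic_between {V : Type*} {G : SimpleGraph V} {H W : G.Subgraph}
    (hW : W.Connected) (hHW : H ≤ W) (hH : H.coe.IsAcyclic) :
    ∃ Z : G.Subgraph, Z.Connected ∧ Z.coe.IsAcyclic ∧ Z.verts = W.verts ∧ H ≤ Z ∧ Z ≤ W := by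
  obtain ⟨F, hHF, hFW, hF⟩ := hW.coe.exists_isTree_le_of_le_of_isAcyclic
    (H := H.spanningCoe.induce W.verts) (fun _ _ h => hHW.2 h)
    ((isAcyclic_spanningCoe hH).induce _)
  let Z : G.Subgraph :=
    { verts := W.verts
      Adj := fun a b => ∃ ha hb, F.Adj ⟨a, ha⟩ ⟨b, hb⟩
      adj_sub := fun ⟨_, _, h⟩ => W.adj_sub (hFW h)
      edge_vert := fun ⟨ha, _, _⟩ => ha
      symm := ⟨fun _ _ ⟨ha, hb, h⟩ => ⟨hb, ha, h.symm⟩⟩ }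
  have hZ : Z.coe = F := by
    ext a b
    exact ⟨fun ⟨_, _, h⟩ => h, fun h => ⟨a.2, b.2, h⟩⟩
  refine ⟨Z, ⟨hZ ▸ hF.connected⟩, hZ ▸ hF.isAcyclic, rfl, ⟨hHW.1, fun a b h => ?_⟩,
    ⟨le_rfl, fun _ _ ⟨_, _, h⟩ => hFW h⟩⟩
  exact ⟨hHW.1 h.fst_mem, hHW.1 h.snd_mem, hHF h⟩

end SimpleGraph.Subgraph


theorem stmt10 {V : Type*} [Fintype V] (G : SimpleGraph V)
    (T' T : Set V) (hTT : T' ⊆ T) (hne : T'.Nonempty)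
    -- `Y` is a Steiner tree over `(G, T)`:
    (Y : G.Subgraph) (hYc : Y.Connected) (hYa : Y.coe.IsAcyclic) (hYT : T ⊆ Y.verts)
    -- `Y'` is a Steiner tree over `(G, T')`:
    (Y' : G.Subgraph) (hY'c : Y'.Connected) (hY'a : Y'.coe.IsAcyclic)
    (hY'T : T' ⊆ Y'.verts) :
    -- they can be merged, pruning only edges of the lower-priority tree `Y`:
    ∃ Z : G.Subgraph, Z.Connected ∧ Z.coe.IsAcyclic ∧ T ⊆ Z.verts ∧
      Y'.edgeSet ⊆ Z.edgeSet ∧ Z.edgeSet ⊆ Y.edgeSet ∪ Y'.edgeSet := by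
  obtain ⟨t, ht⟩ := hne
  have hW : (Y ⊔ Y').Connected := SimpleGraph.Subgraph.connected_sup hYc.preconnected
    hY'c.preconnected ⟨t, hYT (hTT ht), hY'T ht⟩
  obtain ⟨Z, hZc, hZa, hZv, hY'Z, hZW⟩ := hW.exists_isAcyclic_between le_sup_right hY'a
  refine ⟨Z, hZc, hZa, ?_, SimpleGraph.Subgraph.edgeSet_mono hY'Z, ?_⟩
  · rw [hZv]
    exact hYT.trans Set.subset_union_left
  · rw [← SimpleGraph.Subgraph.edgeSet_sup]
    exact SimpleGraph.Subgraph.edgeSet_mono hZW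
end

section
/- Let G be a finite simple graph and let T_k ⊆ T_{k-1} ⊆ … ⊆ T_1 be subsets of the vertex set of G with T_k nonempty. Suppose for each i ∈ {1,…,k} there is a connected acyclic subgraph Y_i of G with T_i ⊆ V(Y_i). Then there exist connected acyclic subgraphs Z_1,…,Z_k of G such that for every i ∈ {1,…,k}: T_i ⊆ V(Z_i), E(Z_i) ⊆ E(Y_i) ∪ E(Y_{i+1}) ∪ … ∪ E(Y_k), and E(Z_k) ⊆ E(Z_{k-1}) ⊆ … ⊆ E(Z_1); that is, independently computed Steiner trees can be merged (with pruning) into a valid k-priority Steiner tree. -/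
namespace SimpleGraph

variable {V : Type*} {G : SimpleGraph V}

lemma Subgraph.isAcyclic_spanningCoe_s11 {H : G.Subgraph} (h : H.coe.IsAcyclic) :
    H.spanningCoe.IsAcyclic := by
  intro u c hc
  have hsupp : ∀ x ∈ c.support, x ∈ H.verts := by
    intro x hx
    obtain ⟨e, he, hxe⟩ := (Walk.mem_support_iff_exists_mem_edges_of_not_nil hc.not_nil).1 hx
    exact H.mem_verts_of_mem_edge (H.edgeSet_spanningCoe ▸ c.edges_subset_edgeSet he) hxe
  have hcyc : (c.induce H.verts hsupp).IsCycle :=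
    Walk.IsCycle.of_map (f := (Embedding.induce H.verts).toHom) (by rwa [Walk.map_induce])
  exact h (c.induce H.verts hsupp) hcyc

/-- A tree sharing a vertex with a connected subgraph extends to a spanning tree of their union. -/
lemma Subgraph.exists_isAcyclic_between_sup {Z Y : G.Subgraph} (hZ : Z.Connected)
    (hZa : Z.coe.IsAcyclic) (hY : Y.Connected) (hZY : (Z.verts ∩ Y.verts).Nonempty) :
    ∃ W : G.Subgraph, W.Connected ∧ W.coe.IsAcyclic ∧ Z ≤ W ∧ W ≤ Z ⊔ Y ∧
      W.verts = Z.verts ∪ Y.verts := by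
  obtain ⟨F, hZF, hFK, hF⟩ := (connected_sup hZ.preconnected hY.preconnected hZY).coe.exists_isTree_le_of_le_of_isAcyclic
    (H := Z.spanningCoe.comap Subtype.val) (fun _ _ h => Or.inl h)
    ((isAcyclic_spanningCoe_s11 hZa).of_comap (Function.Embedding.subtype _))
  let W : G.Subgraph :=
    { verts := (Z ⊔ Y).verts
      Adj a b := ∃ ha hb, F.Adj ⟨a, ha⟩ ⟨b, hb⟩
      adj_sub := fun ⟨_, _, h⟩ => (Z ⊔ Y).adj_sub (hFK h)
      edge_vert := fun ⟨ha, _, _⟩ => ha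
      symm := ⟨fun _ _ ⟨ha, hb, h⟩ => ⟨hb, ha, h.symm⟩⟩ }
  have hWF : W.coe = F := by
    ext a b
    exact ⟨fun ⟨_, _, h⟩ => h, fun h => ⟨a.2, b.2, h⟩⟩
  refine ⟨W, ⟨hWF ▸ hF.1⟩, hWF ▸ hF.2, ⟨Set.subset_union_left, fun a b h => ?_⟩,
    ⟨le_rfl, fun _ _ ⟨_, _, h⟩ => hFK h⟩, rfl⟩
  exact ⟨Or.inl h.fst_mem, Or.inl h.snd_mem, hZF h⟩

end SimpleGraph

theorem stmt11 {V : Type*} [Fintype V] (G : SimpleGraph V)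
    (k : ℕ) (hk : 1 ≤ k)
    -- `T k ⊆ T (k-1) ⊆ … ⊆ T 1`, with `T k` nonempty:
    (T : ℕ → Set V)
    (hnest : ∀ i, 1 ≤ i → i < k → T (i + 1) ⊆ T i)
    (hne : (T k).Nonempty)
    -- for each `i ∈ {1,…,k}`, `Y i` is a Steiner tree over `(G, T i)`:
    (Y : ℕ → G.Subgraph)
    (hYc : ∀ i, 1 ≤ i → i ≤ k → (Y i).Connected)
    (hYa : ∀ i, 1 ≤ i → i ≤ k → (Y i).coe.IsAcyclic)
    (hYT : ∀ i, 1 ≤ i → i ≤ k → T i ⊆ (Y i).verts) :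
    -- the trees can be merged (with pruning) into a valid `k`-priority Steiner tree:
    ∃ Z : ℕ → G.Subgraph,
      (∀ i, 1 ≤ i → i ≤ k →
        (Z i).Connected ∧ (Z i).coe.IsAcyclic ∧ T i ⊆ (Z i).verts ∧
        (Z i).edgeSet ⊆ ⋃ t ∈ Set.Icc i k, (Y t).edgeSet) ∧
      ∀ i, 1 ≤ i → i < k → (Z (i + 1)).edgeSet ⊆ (Z i).edgeSet := by
  have hTk : ∀ i (_ : i ≤ k), 1 ≤ i → T k ⊆ T i := by
    intro i hi
    induction hi using Nat.decreasingInduction with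
    | self => exact fun _ => subset_rfl
    | of_succ i hik ih => exact fun h => (ih (by omega)).trans (hnest i h hik)
  suffices h : ∀ j (_ : j ≤ k), 1 ≤ j → ∃ Z : ℕ → G.Subgraph,
      (∀ i, j ≤ i → i ≤ k →
        (Z i).Connected ∧ (Z i).coe.IsAcyclic ∧ T i ⊆ (Z i).verts ∧
        (Z i).edgeSet ⊆ ⋃ t ∈ Set.Icc i k, (Y t).edgeSet) ∧
      ∀ i, j ≤ i → i < k → (Z (i + 1)).edgeSet ⊆ (Z i).edgeSet from h 1 hk le_rfl
  intro j hj
  induction hj using Nat.decreasingInduction with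
  | self =>
    refine fun _ => ⟨Y, fun i hki hik => ?_, fun i hki hik => by omega⟩
    have hi : 1 ≤ i := hk.trans hki
    exact ⟨hYc i hi hik, hYa i hi hik, hYT i hi hik,
      Set.subset_biUnion_of_mem (u := fun t => (Y t).edgeSet) (Set.left_mem_Icc.2 hik)⟩
  | of_succ j hjk ih =>
    intro hj
    obtain ⟨Z, hZ, hmono⟩ := ih (by omega)
    obtain ⟨hc, ha, hT, hE⟩ := hZ (j + 1) le_rfl hjk
    obtain ⟨v, hv⟩ := hne
    obtain ⟨W, hWc, hWa, hZW, hWle, hWv⟩ := SimpleGraph.Subgraph.exists_isAcyclic_between_sup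
      hc ha (hYc j hj hjk.le)
      ⟨v, hT (hTk (j + 1) hjk (by omega) hv), hYT j hj hjk.le (hTk j hjk.le hj hv)⟩
    refine ⟨Function.update Z j W, fun i hji hik => ?_, fun i hji hik => ?_⟩
    · obtain rfl | hji := hji.eq_or_lt
      · rw [Function.update_self]
        refine ⟨hWc, hWa, (hYT j hj hjk.le).trans (hWv ▸ Set.subset_union_right), ?_⟩
        refine (SimpleGraph.Subgraph.edgeSet_mono hWle).trans ?_
        rw [SimpleGraph.Subgraph.edgeSet_sup]
        refine Set.union_subset (hE.trans ?_) ?_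
        · exact Set.biUnion_subset_biUnion_left (Set.Icc_subset_Icc_left j.le_succ)
        · exact Set.subset_biUnion_of_mem (u := fun t => (Y t).edgeSet)
            (Set.left_mem_Icc.2 hjk.le)
      · rw [Function.update_of_ne hji.ne']
        exact hZ i hji hik
    · rw [Function.update_of_ne (by omega)]
      obtain rfl | hji := hji.eq_or_lt
      · rw [Function.update_self]
        exact SimpleGraph.Subgraph.edgeSet_mono hZW
      · rw [Function.update_of_ne hji.ne']
        exact hmono i hji hik
end

section
/- Let t ≥ 1 and L : ℕ → ℝ with L(n) ≥ 0. Assume that for every finite metric space (X, d) there exists a set P of unordered pairs of distinct points of X such that d_P(u,v) ≤ t·d(u,v) for all u, v ∈ X and w_d(P) ≤ L(|X|)·mst(X,d). Then for every finite connected simple graph G with positive edge weights w and every nonempty subset T of its vertices, there exists a subgraph H of G such that d_H^w(u,v) ≤ t·d_G^w(u,v) for all u, v ∈ T, and the total edge weight of H is at most 2·L(|T|)·st_w(G,T); that is, light spanners for finite metric spaces yield light subset spanners whose lightness is measured against the minimum Steiner tree. -/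
/-- The total distance along a finite chain of points `x_0, x_1, …, x_p`:
`Σ_{q} d(x_q, x_{q+1})`. -/
noncomputable def chainWeight {X : Type*} [MetricSpace X] (l : List X) : ℝ :=
  ((l.zip l.tail).map fun q => dist q.1 q.2).sum

/-- `w_d(P) = Σ_{{x,y} ∈ P} d(x,y)` for a set `P` of unordered pairs. -/
noncomputable def pairsWeight {X : Type*} [MetricSpace X] (P : Finset (Sym2 X)) : ℝ :=
  ∑ p ∈ P, Sym2.lift ⟨fun a b => dist a b, fun a b => dist_comm a b⟩ p

/-- The total `d`-weight of the edges of a graph `S` (used for trees on `X`). -/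
noncomputable def graphDistWeight {X : Type*} [MetricSpace X] [Finite X]
    (S : SimpleGraph X) : ℝ :=
  ∑ e ∈ S.edgeSet.toFinite.toFinset,
    Sym2.lift ⟨fun a b => dist a b, fun a b => dist_comm a b⟩ e

/-- The `w`-weight of a walk: the sum of the weights of its edges. -/
noncomputable def walkWeight {V : Type*} {G : SimpleGraph V} (w : Sym2 V → ℝ)
    {u v : V} (p : G.Walk u v) : ℝ :=
  (p.edges.map w).sum

/-- The total `w`-weight of the edges of a subgraph. -/
noncomputable def subgraphWeight {V : Type*} [Finite V] {G : SimpleGraph V}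
    (w : Sym2 V → ℝ) (H : G.Subgraph) : ℝ :=
  ∑ e ∈ H.edgeSet.toFinite.toFinset, w e

lemma sum_biUnion_le_sum {ι α : Type*} [DecidableEq α] (s : Finset ι) (F : ι → Finset α)
    {f : α → ℝ} (hf : ∀ i ∈ s, ∀ a ∈ F i, 0 ≤ f a) :
    ∑ a ∈ s.biUnion F, f a ≤ ∑ i ∈ s, ∑ a ∈ F i, f a := by
  classical
  induction s using Finset.induction_on with
  | empty => simp
  | insert i s hi ih =>
    have h := Finset.sum_union_inter (s₁ := F i) (s₂ := s.biUnion F) (f := f)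
    have h' : 0 ≤ ∑ a ∈ F i ∩ s.biUnion F, f a := Finset.sum_nonneg fun a ha =>
      hf i (Finset.mem_insert_self i s) a (Finset.mem_inter.1 ha).1
    rw [Finset.biUnion_insert, Finset.sum_insert hi]
    linarith [ih fun j hj => hf j (Finset.mem_insert_of_mem hj)]

section ChainWeight

variable {X : Type*} [MetricSpace X]

lemma chainWeight_cons_cons (a b : X) (l : List X) :
    chainWeight (a :: b :: l) = dist a b + chainWeight (b :: l) := by
  simp [chainWeight]

lemma chainWeight_le_cons (a : X) (l : List X) : chainWeight l ≤ chainWeight (a :: l) := by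
  cases l with
  | nil => simp [chainWeight]
  | cons b l => rw [chainWeight_cons_cons]; linarith [dist_nonneg (x := a) (y := b)]

lemma chainWeight_cons_le_cons_cons (a b : X) (l : List X) :
    chainWeight (a :: l) ≤ chainWeight (a :: b :: l) := by
  cases l with
  | nil => simp [chainWeight]
  | cons c l =>
    simp only [chainWeight_cons_cons]
    linarith [dist_triangle a b c]

lemma chainWeight_cons_le_of_sublist {l₁ l₂ : List X} (h : l₁.Sublist l₂) (a : X) :
    chainWeight (a :: l₁) ≤ chainWeight (a :: l₂) := by
  induction h generalizing a with
  | slnil => exact le_rfl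
  | cons b _ ih => exact (ih a).trans (chainWeight_cons_le_cons_cons a b _)
  | cons_cons b _ ih => simpa only [chainWeight_cons_cons] using add_le_add_right (ih b) _

/-- By the triangle inequality, shortcutting a chain does not increase its weight. -/
lemma chainWeight_le_of_sublist {l₁ l₂ : List X} (h : l₁.Sublist l₂) :
    chainWeight l₁ ≤ chainWeight l₂ := by
  induction h with
  | slnil => exact le_rfl
  | cons b _ ih => exact ih.trans (chainWeight_le_cons b _)
  | cons_cons b h _ => exact chainWeight_cons_le_of_sublist h b

lemma chainWeight_map_val {s : Set X} (l : List s) :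
    chainWeight (l.map Subtype.val) = chainWeight l := by
  induction l with
  | nil => simp [chainWeight]
  | cons a l ih =>
    cases l with
    | nil => simp [chainWeight]
    | cons b l =>
      simp only [List.map_cons, chainWeight_cons_cons] at ih ⊢
      rw [ih, Subtype.dist_eq]

lemma sym2_dist_nonneg (e : Sym2 X) :
    0 ≤ Sym2.lift ⟨fun a b : X => dist a b, fun a b => dist_comm a b⟩ e := by
  induction e with
  | _ a b => exact dist_nonneg

lemma graphDistWeight_mono [Finite X] {S S' : SimpleGraph X} (h : S ≤ S') :
    graphDistWeight S ≤ graphDistWeight S' := by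
  refine Finset.sum_le_sum_of_subset_of_nonneg ?_ fun e _ _ => sym2_dist_nonneg e
  simpa using h

lemma graphDistWeight_sup_edge_le [Finite X] (S : SimpleGraph X) (a b : X) :
    graphDistWeight (S ⊔ SimpleGraph.edge a b) ≤ dist a b + graphDistWeight S := by
  classical
  unfold graphDistWeight
  have hsub : (S ⊔ SimpleGraph.edge a b).edgeSet.toFinite.toFinset ⊆
      {s(a, b)} ∪ S.edgeSet.toFinite.toFinset := by
    intro e he
    rw [Set.Finite.mem_toFinset, SimpleGraph.edgeSet_sup] at he
    rw [Finset.mem_union, Set.Finite.mem_toFinset, Finset.mem_singleton]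
    exact he.symm.imp (fun h => SimpleGraph.edgeSet_edge_subset h) id
  refine (Finset.sum_le_sum_of_subset_of_nonneg hsub fun e _ _ => sym2_dist_nonneg e).trans ?_
  have h := Finset.sum_union_inter (s₁ := {s(a, b)}) (s₂ := S.edgeSet.toFinite.toFinset)
    (f := Sym2.lift ⟨fun a b : X => dist a b, fun a b => dist_comm a b⟩)
  have h' := Finset.sum_nonneg (s := {s(a, b)} ∩ S.edgeSet.toFinite.toFinset)
    fun e _ => sym2_dist_nonneg e
  rw [Finset.sum_singleton, Sym2.lift_mk] at h
  linarith

lemma exists_reachable_graphDistWeight_le [Finite X] (l : List X) :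
    ∃ S : SimpleGraph X, (∀ a ∈ l, ∀ b ∈ l, S.Reachable a b) ∧
      graphDistWeight S ≤ chainWeight l := by
  induction l with
  | nil => exact ⟨⊥, by simp, by simp [graphDistWeight, chainWeight]⟩
  | cons a l ih =>
    cases l with
    | nil => exact ⟨⊥, by simp, by simp [graphDistWeight, chainWeight]⟩
    | cons b l =>
      obtain ⟨S, hS, hw⟩ := ih
      have hab : (S ⊔ SimpleGraph.edge a b).Reachable a b := by
        by_cases h : a = b
        · rw [h]
        · exact SimpleGraph.Adj.reachable (by simp [SimpleGraph.edge_adj, h])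
      have hb : ∀ x ∈ a :: b :: l, (S ⊔ SimpleGraph.edge a b).Reachable x b := by
        intro x hx
        rcases List.mem_cons.1 hx with rfl | hx
        · exact hab
        · exact (hS x hx b (by simp)).mono le_sup_left
      refine ⟨S ⊔ SimpleGraph.edge a b, fun x hx y hy => (hb x hx).trans (hb y hy).symm, ?_⟩
      rw [chainWeight_cons_cons]
      linarith [graphDistWeight_sup_edge_le S a b]

/-- A chain visiting every point of a finite metric space is at least as heavy as some
spanning tree. -/
lemma exists_isTree_graphDistWeight_le [Finite X] [Nonempty X] (l : List X) (hl : ∀ x, x ∈ l) :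
    ∃ S : SimpleGraph X, S.IsTree ∧ graphDistWeight S ≤ chainWeight l := by
  obtain ⟨S, hS, hw⟩ := exists_reachable_graphDistWeight_le l
  obtain ⟨S', hle, hS'⟩ :=
    SimpleGraph.Connected.exists_isTree_le (G := S) ⟨fun a b => hS a (hl a) b (hl b)⟩
  exact ⟨S', hS', (graphDistWeight_mono hle).trans hw⟩

end ChainWeight

section WalkWeight

variable {V : Type*} {G : SimpleGraph V} (w : Sym2 V → ℝ)

lemma walkWeight_nil (u : V) : walkWeight w (SimpleGraph.Walk.nil : G.Walk u u) = 0 := by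
  simp [walkWeight]

lemma walkWeight_cons {u v x : V} (h : G.Adj u v) (p : G.Walk v x) :
    walkWeight w (SimpleGraph.Walk.cons h p) = w s(u, v) + walkWeight w p := by
  simp [walkWeight]

lemma walkWeight_append {u v x : V} (p : G.Walk u v) (q : G.Walk v x) :
    walkWeight w (p.append q) = walkWeight w p + walkWeight w q := by
  simp [walkWeight, SimpleGraph.Walk.edges_append]

lemma walkWeight_reverse {u v : V} (p : G.Walk u v) :
    walkWeight w p.reverse = walkWeight w p := by
  simp [walkWeight, SimpleGraph.Walk.edges_reverse, List.sum_reverse]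

variable {w}

lemma walkWeight_nonneg (hw : ∀ e ∈ G.edgeSet, 0 < w e) {u v : V} (p : G.Walk u v) :
    0 ≤ walkWeight w p := by
  refine List.sum_nonneg fun x hx => ?_
  obtain ⟨e, he, rfl⟩ := List.mem_map.1 hx
  exact (hw e (p.edges_subset_edgeSet he)).le

lemma walkWeight_bypass_le [DecidableEq V] (hw : ∀ e ∈ G.edgeSet, 0 < w e) {u v : V}
    (p : G.Walk u v) : walkWeight w p.bypass ≤ walkWeight w p := by
  refine (p.edges_bypass_sublist_edges.map w).sum_le_sum fun x hx => ?_
  obtain ⟨e, he, rfl⟩ := List.mem_map.1 hx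
  exact (hw e (p.edges_subset_edgeSet he)).le

lemma sum_edges_toFinset_le_walkWeight [DecidableEq V] (hw : ∀ e ∈ G.edgeSet, 0 < w e) {u v : V}
    (p : G.Walk u v) : ∑ e ∈ p.edges.toFinset, w e ≤ walkWeight w p := by
  have hdedup : p.edges.toFinset = p.edges.dedup.toFinset := by
    ext e
    simp
  rw [walkWeight, hdedup, List.sum_toFinset w (List.nodup_dedup _)]
  refine ((List.dedup_sublist p.edges).map w).sum_le_sum fun x hx => ?_
  obtain ⟨e, he, rfl⟩ := List.mem_map.1 hx
  exact (hw e (p.edges_subset_edgeSet he)).le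

lemma exists_walkWeight_le [Finite V] (hG : G.Connected) (hw : ∀ e ∈ G.edgeSet, 0 < w e)
    (u v : V) : ∃ p : G.Walk u v, ∀ q : G.Walk u v, walkWeight w p ≤ walkWeight w q := by
  classical
  have := Fintype.ofFinite V
  obtain ⟨p₀⟩ := hG.preconnected u v
  have : Nonempty (G.Path u v) := ⟨p₀.toPath⟩
  obtain ⟨p, hp⟩ := Finite.exists_min fun p : G.Path u v => walkWeight w p.1
  exact ⟨p.1, fun q => (hp q.toPath).trans (walkWeight_bypass_le hw q)⟩

/-- The weighted distance of a finite connected graph is a metric, and it is attained by walks. -/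
lemma exists_metricSpace_walkWeight [Finite V] (hG : G.Connected)
    (hw : ∀ e ∈ G.edgeSet, 0 < w e) :
    ∃ m : MetricSpace V, (∀ (u v : V) (p : G.Walk u v), m.dist u v ≤ walkWeight w p) ∧
      ∀ u v : V, ∃ p : G.Walk u v, walkWeight w p = m.dist u v := by
  choose q hq using exists_walkWeight_le hG hw
  refine ⟨{
    dist := fun u v => walkWeight w (q u v)
    dist_self := fun u => le_antisymm ((hq u u .nil).trans_eq (walkWeight_nil w u))
      (walkWeight_nonneg hw _)
    dist_comm := fun u v => le_antisymm
      ((hq u v (q v u).reverse).trans_eq (walkWeight_reverse w _))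
      ((hq v u (q u v).reverse).trans_eq (walkWeight_reverse w _))
    dist_triangle := fun u v x =>
      (hq u x ((q u v).append (q v x))).trans_eq (walkWeight_append w _ _)
    eq_of_dist_eq_zero := fun {u v} h => ?_ }, fun u v p => hq u v p, fun u v => ⟨q u v, rfl⟩⟩
  change walkWeight w (q u v) = 0 at h
  cases hp : q u v with
  | nil => rfl
  | cons hadj p =>
    rw [hp, walkWeight_cons] at h
    linarith [hw _ (G.mem_edgeSet.2 hadj), walkWeight_nonneg hw p]

lemma chainWeight_support_le [MetricSpace V]
    (hd : ∀ (u v : V) (p : G.Walk u v), dist u v ≤ walkWeight w p) {u v : V} (p : G.Walk u v) :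
    chainWeight p.support ≤ walkWeight w p := by
  induction p with
  | nil => simp [chainWeight, walkWeight]
  | cons h p ih =>
    have := hd _ _ h.toWalk
    rw [SimpleGraph.Adj.toWalk, walkWeight_cons, walkWeight_nil] at this
    rw [SimpleGraph.Walk.support_cons, walkWeight_cons, ← SimpleGraph.Walk.cons_tail_support,
      chainWeight_cons_cons, SimpleGraph.Walk.cons_tail_support]
    linarith

/-- Doubling the edges of a connected subgraph gives a closed walk visiting all its vertices. -/
lemma exists_closed_walk_le_two_mul [Finite V] {Y : G.Subgraph} (hY : Y.Connected)
    (hw : ∀ e ∈ G.edgeSet, 0 < w e) {r : V} (hr : r ∈ Y.verts) :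
    ∃ p : G.Walk r r, Y.verts ⊆ {v | v ∈ p.support} ∧
      walkWeight w p ≤ 2 * subgraphWeight w Y := by
  classical
  have := Fintype.ofFinite V
  let good : Finset (Sym2 V) → Prop := fun F => (F : Set (Sym2 V)) ⊆ Y.edgeSet ∧
    ∃ p : G.Walk r r, (∀ e ∈ F, ∀ v ∈ e, v ∈ p.support) ∧ walkWeight w p ≤ 2 * ∑ e ∈ F, w e
  have hne : good ∅ := ⟨by simp, .nil, by simp, by simp [walkWeight]⟩
  obtain ⟨F, hF⟩ := (Set.toFinite {F | good F}).exists_maximal ⟨∅, hne⟩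
  obtain ⟨hFY, p, hp, hpw⟩ := hF.prop
  refine ⟨p, fun v hv => ?_, hpw.trans ?_⟩
  · by_contra hvp
    obtain ⟨q⟩ := hY.preconnected.coe ⟨r, hr⟩ ⟨v, hv⟩
    obtain ⟨⟨⟨a, b⟩, hab⟩, -, ha, hb⟩ :=
      q.exists_boundary_dart {x | x.1 ∈ p.support} p.start_mem_support hvp
    have hab' : Y.Adj a b := hab
    have ha : (a : V) ∈ p.support := ha
    have hb : (b : V) ∉ p.support := hb
    have hnot : s((a : V), (b : V)) ∉ F := fun h => hb (hp _ h _ (Sym2.mem_mk_right _ _))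
    refine hnot (hF.le_of_ge (y := insert s((a : V), (b : V)) F) ⟨?_, ?_⟩
      (Finset.subset_insert _ _) (Finset.mem_insert_self _ _))
    · rw [Finset.coe_insert, Set.insert_subset_iff]
      exact ⟨hab', hFY⟩
    · let p' := (p.takeUntil a ha).append
        (.cons hab'.adj_sub (.cons hab'.adj_sub.symm (p.dropUntil a ha)))
      have hsupp : ∀ x, x ∈ p'.support ↔ x ∈ p.support ∨ x = b := by
        intro x
        have := p.take_spec ha
        conv_rhs => rw [← this]
        simp only [p', SimpleGraph.Walk.mem_support_append_iff, SimpleGraph.Walk.support_cons,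
          List.mem_cons]
        have := (p.takeUntil a ha).end_mem_support
        grind
      refine ⟨p', fun e he v hv => ?_, ?_⟩
      · rw [hsupp]
        rcases Finset.mem_insert.1 he with rfl | he
        · rcases Sym2.mem_iff.1 hv with rfl | rfl
          · exact .inl ha
          · exact .inr rfl
        · exact .inl (hp e he v hv)
      · have h := congrArg (walkWeight w) (p.take_spec ha)
        rw [walkWeight_append] at h
        rw [Finset.sum_insert hnot, walkWeight_append, walkWeight_cons, walkWeight_cons,
          Sym2.eq_swap (a := (b : V))]
        linarith
  · refine mul_le_mul_of_nonneg_left (Finset.sum_le_sum_of_subset_of_nonneg ?_ ?_) zero_le_two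
    · intro e he
      simpa using hFY he
    · intro e he _
      exact (hw e (Y.edgeSet_subset (by simpa using he))).le

/-- The minimum spanning tree of the terminals weighs at most twice any connected subgraph
containing them. -/
lemma exists_isTree_graphDistWeight_le_two_mul [Finite V] [MetricSpace V]
    (hd : ∀ (u v : V) (p : G.Walk u v), dist u v ≤ walkWeight w p)
    (hw : ∀ e ∈ G.edgeSet, 0 < w e) {T : Set V} (hT : T.Nonempty) {Y : G.Subgraph}
    (hY : Y.Connected) (hTY : T ⊆ Y.verts) :
    ∃ S : SimpleGraph T, S.IsTree ∧ graphDistWeight S ≤ 2 * subgraphWeight w Y := by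
  classical
  obtain ⟨r, hr⟩ := hT
  obtain ⟨p, hp, hpw⟩ := exists_closed_walk_le_two_mul hY hw (hTY hr)
  have : Nonempty T := ⟨⟨r, hr⟩⟩
  obtain ⟨l, hl⟩ : ∃ l : List T, l.map Subtype.val = p.support.filter (· ∈ T) :=
    CanLift.prf (p.support.filter (· ∈ T)) (by simp)
  obtain ⟨S, hS, hSw⟩ := exists_isTree_graphDistWeight_le l fun x => by
    have : (x : V) ∈ l.map Subtype.val := by
      rw [hl, List.mem_filter]
      exact ⟨hp (hTY x.2), by simp⟩
    simpa using this
  refine ⟨S, hS, hSw.trans ?_⟩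
  rw [← chainWeight_map_val, hl]
  exact (chainWeight_le_of_sublist List.filter_sublist).trans
    ((chainWeight_support_le hd p).trans hpw)

lemma exists_walk_of_chain [MetricSpace V] {T : Set V} {P : Finset (Sym2 T)} {F : Set (Sym2 V)}
    (hP : ∀ a b : T, s(a, b) ∈ P → ∃ p : G.Walk a b, (∀ e ∈ p.edges, e ∈ F) ∧
      walkWeight w p ≤ dist a b) (l : List T) (u v : T) (hu : l.head? = some u)
    (hv : l.getLast? = some v) (hl : l.IsChain fun a b => s(a, b) ∈ P) :
    ∃ p : G.Walk u v, (∀ e ∈ p.edges, e ∈ F) ∧ walkWeight w p ≤ chainWeight l := by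
  induction l generalizing u with
  | nil => simp at hu
  | cons a l ih =>
    obtain rfl : a = u := by simpa using hu
    cases l with
    | nil =>
      obtain rfl : a = v := by simpa using hv
      exact ⟨.nil, by simp, by simp [walkWeight, chainWeight]⟩
    | cons b l =>
      rw [List.isChain_cons_cons] at hl
      obtain ⟨p, hpF, hpw⟩ := hP a b hl.1
      obtain ⟨q, hqF, hqw⟩ := ih b rfl (by simpa using hv) hl.2
      refine ⟨p.append q, fun e he => ?_, ?_⟩
      · rw [SimpleGraph.Walk.edges_append, List.mem_append] at he
        exact he.elim (hpF e) (hqF e)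
      · rw [walkWeight_append, chainWeight_cons_cons]
        linarith

/-- Replacing each pair of `P` by a shortest walk realizes `P` as a subgraph of no larger
weight. -/
lemma exists_subgraph_of_pairs [Finite V] [MetricSpace V]
    (hd : ∀ u v : V, ∃ p : G.Walk u v, walkWeight w p = dist u v)
    (hw : ∀ e ∈ G.edgeSet, 0 < w e) {T : Set V} (P : Finset (Sym2 T)) :
    ∃ H : G.Subgraph, (∀ a b : T, s(a, b) ∈ P → ∃ p : G.Walk a b,
      (∀ e ∈ p.edges, e ∈ H.edgeSet) ∧ walkWeight w p ≤ dist a b) ∧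
      subgraphWeight w H ≤ pairsWeight P := by
  classical
  choose q hq using hd
  let F : Finset (Sym2 V) := P.biUnion fun x => (q x.out.1 x.out.2).edges.toFinset
  have hF : ∀ e ∈ F, e ∈ G.edgeSet := by
    intro e he
    obtain ⟨x, -, hx⟩ := Finset.mem_biUnion.1 he
    exact SimpleGraph.Walk.edges_subset_edgeSet _ (List.mem_toFinset.1 hx)
  let H : G.Subgraph :=
    { verts := Set.univ
      Adj := fun a b => s(a, b) ∈ F
      adj_sub := fun h => hF _ h
      edge_vert := fun _ => Set.mem_univ _
      symm := ⟨fun a b h => by rwa [Sym2.eq_swap]⟩ }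
  have hH : H.edgeSet = F := by
    ext e
    induction e with
    | _ a b => rfl
  refine ⟨H, fun a b hab => ?_, ?_⟩
  · have hmem : ∀ e ∈ (q s(a, b).out.1 s(a, b).out.2).edges, e ∈ H.edgeSet := by
      intro e he
      rw [hH]
      exact Finset.mem_biUnion.2 ⟨_, hab, List.mem_toFinset.2 he⟩
    have hout : s(s(a, b).out.1, s(a, b).out.2) = s(a, b) := Quot.out_eq s(a, b)
    generalize s(a, b).out.1 = c, s(a, b).out.2 = d at hmem hout
    rcases Sym2.eq_iff.1 hout with ⟨rfl, rfl⟩ | ⟨rfl, rfl⟩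
    · exact ⟨_, hmem, (hq _ _).le⟩
    · refine ⟨(q c d).reverse, by simpa using hmem, ?_⟩
      rw [walkWeight_reverse, hq, dist_comm, Subtype.dist_eq]
  · have hE : H.edgeSet.toFinite.toFinset = F := by
      ext e
      rw [Set.Finite.mem_toFinset, hH, Finset.mem_coe]
    rw [subgraphWeight, hE]
    refine (sum_biUnion_le_sum P _ fun x _ e he => (hw e ?_).le).trans
      (Finset.sum_le_sum fun x _ => (sum_edges_toFinset_le_walkWeight hw _).trans_eq ?_)
    · exact SimpleGraph.Walk.edges_subset_edgeSet _ (List.mem_toFinset.1 he)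
    · rw [hq]
      conv_rhs => rw [← Quot.out_eq x]
      rfl

end WalkWeight

theorem stmt16 (t : ℝ) (ht : 1 ≤ t) (L : ℕ → ℝ) (hL : ∀ n, 0 ≤ L n)
    -- every finite metric space `(X, d)` has a spanner `P` (a set of unordered
    -- pairs of distinct points) of stretch `t` with `w_d(P) ≤ L(|X|)·mst(X,d)`:
    (hmetric : ∀ (X : Type) [MetricSpace X] [Fintype X],
      ∃ P : Finset (Sym2 X), (∀ p ∈ P, ¬ p.IsDiag) ∧
        -- `d_P(u,v) ≤ t·d(u,v)` for all `u, v ∈ X`: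
        (∀ u v : X, ∃ l : List X, l.head? = some u ∧ l.getLast? = some v ∧
          l.Chain' (fun a b => s(a, b) ∈ P) ∧ chainWeight l ≤ t * dist u v) ∧
        -- `w_d(P) ≤ L(|X|)·mst(X,d)`, i.e. `w_d(P) ≤ L(|X|)·weight(S)` for
        -- every tree `S` on vertex set `X`:
        (∀ S : SimpleGraph X, S.IsTree → pairsWeight P ≤
          L (Fintype.card X) * graphDistWeight S))
    -- then every connected positively weighted graph `G` and nonempty terminal
    -- set `T` admit a subset spanner `H` of stretch `t` whose total weight is
    -- at most `2·L(|T|)·st_w(G,T)`: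
    (V : Type) [Fintype V] (G : SimpleGraph V) (hG : G.Connected)
    (w : Sym2 V → ℝ) (hw : ∀ e ∈ G.edgeSet, 0 < w e)
    (T : Set V) (hT : T.Nonempty) :
    ∃ H : G.Subgraph,
      -- `d_H^w(u,v) ≤ t·d_G^w(u,v)` for all `u, v ∈ T`:
      (∀ u v : V, u ∈ T → v ∈ T → ∀ q : G.Walk u v,
        ∃ p : G.Walk u v, (∀ e ∈ p.edges, e ∈ H.edgeSet) ∧
          walkWeight w p ≤ t * walkWeight w q) ∧
      -- the total weight of `H` is at most `2·L(|T|)` times the weight of any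
      -- Steiner tree over `(G, T)`:
      ∀ Y : G.Subgraph, Y.Connected → Y.coe.IsAcyclic → T ⊆ Y.verts →
        subgraphWeight w H ≤ 2 * L T.ncard * subgraphWeight w Y := by
  obtain ⟨m, hle, hattained⟩ := exists_metricSpace_walkWeight hG hw
  have := Fintype.ofFinite T
  obtain ⟨P, -, hP, hPw⟩ := hmetric T
  obtain ⟨H, hH, hHw⟩ := exists_subgraph_of_pairs hattained hw P
  refine ⟨H, fun u v hu hv q => ?_, fun Y hY _ hTY => ?_⟩
  · obtain ⟨l, hlu, hlv, hl, hlw⟩ := hP ⟨u, hu⟩ ⟨v, hv⟩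
    obtain ⟨p, hpH, hpw⟩ := exists_walk_of_chain hH l _ _ hlu hlv hl
    exact ⟨p, hpH, hpw.trans (hlw.trans
      (mul_le_mul_of_nonneg_left (hle u v q) (zero_le_one.trans ht)))⟩
  · obtain ⟨S, hS, hSw⟩ := exists_isTree_graphDistWeight_le_two_mul hle hw hT hY hTY
    have hcard : Fintype.card T = T.ncard := by
      rw [← Nat.card_eq_fintype_card, Nat.card_coe_set_eq]
    have h := hHw.trans (hPw S hS)
    rw [hcard] at h
    calc subgraphWeight w H ≤ L T.ncard * graphDistWeight S := h
      _ ≤ L T.ncard * (2 * subgraphWeight w Y) := mul_le_mul_of_nonneg_left hSw (hL _)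
      _ = 2 * L T.ncard * subgraphWeight w Y := by ring
end
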